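/- arXiv:1412.4838 — 3 statements merged into one kernel-verified Lean document; each statement's English description precedes it below -/
import Mathlib

section
/- Let Ω ⊆ ℝ³ be a connected open set containing S₃, and let r : ℝ³ → ℝ be real-analytic on Ω (AnalyticOn ℝ) with r(p) = 0 for every p ∈ S₃. Then r is identically zero on Ω. (In particular, S₃ is not the common zero set of any family of real-analytic functions defined on a connected neighbourhood of S₃, i.e. S₃ is not C-analytic.) -/
/-- `t x y = x - sin(1/(y+2))`. -/
noncomputable def tfun (x y : ℝ) : ℝ := x - Real.sin (1 / (y + 2))

/-- The variety `S₂ ⊆ ℝ³`. -/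
def S2 : Set (ℝ × ℝ × ℝ) :=
  {p | -2 < p.2.1 ∧ p.2.1 < 2 ∧
    p.2.2 ^ 2 = (1 - tfun p.1 p.2.1 ^ 2 - p.2.1 ^ 2) * tfun p.1 p.2.1 ^ 2}

/-- `S₃ = S₂ ∪ {z = 0}`. -/
def S3 : Set (ℝ × ℝ × ℝ) := S2 ∪ {p | p.2.2 = 0}

open Set Filter Topology

/-- The partial derivative in the third coordinate direction. -/
noncomputable def partialZ (f : ℝ × ℝ × ℝ → ℝ) (p : ℝ × ℝ × ℝ) : ℝ :=
  fderiv ℝ f p (0, 0, 1)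

lemma AnalyticOnNhd.partialZ {Ω : Set (ℝ × ℝ × ℝ)} {f : ℝ × ℝ × ℝ → ℝ}
    (hf : AnalyticOnNhd ℝ f Ω) : AnalyticOnNhd ℝ (partialZ f) Ω := fun p hp =>
  ((ContinuousLinearMap.apply ℝ ℝ ((0, 0, 1) : ℝ × ℝ × ℝ)).analyticAt _).comp (hf.fderiv p hp)

lemma hasDerivAt_partialZ {f : ℝ × ℝ × ℝ → ℝ} {x y z : ℝ} (hf : AnalyticAt ℝ f (x, y, z)) :
    HasDerivAt (fun w => f (x, y, w)) (partialZ f (x, y, z)) z :=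
  hf.differentiableAt.hasFDerivAt.comp_hasDerivAt z
    ((hasDerivAt_const z x).prodMk ((hasDerivAt_const z y).prodMk (hasDerivAt_id z)))

/-- In each plane of constant `y` with `|y| < 1`, zeros of `f` with `z > 0` accumulate at the
point `x = sin (1 / (y + 2))`, `z = 0`. -/
def ZerosAccumulate (f : ℝ × ℝ × ℝ → ℝ) : Prop :=
  ∀ y ∈ Ioo (-1 : ℝ) 1, ∀ ε > 0, ∃ x z : ℝ,
    |x - Real.sin (1 / (y + 2))| < ε ∧ 0 < z ∧ z < ε ∧ f (x, y, z) = 0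

lemma zerosAccumulate_of_vanish {r : ℝ × ℝ × ℝ → ℝ} (h : ∀ p : ℝ × ℝ × ℝ, p ∈ S2 → r p = 0) :
    ZerosAccumulate r := by
  intro y hy ε hε
  obtain ⟨h1, h2⟩ := hy
  have hs : 0 < 1 - y ^ 2 := by nlinarith
  obtain ⟨t, ht0, htε, hts⟩ : ∃ t : ℝ, 0 < t ∧ t < ε ∧ t < 1 - y ^ 2 := by
    obtain ⟨t, ht, ht'⟩ := exists_between (lt_min hε hs)
    exact ⟨t, ht, lt_min_iff.1 ht'⟩
  have hq : 0 < 1 - t ^ 2 - y ^ 2 := by nlinarith [sq_nonneg y]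
  refine ⟨Real.sin (1 / (y + 2)) + t, t * √(1 - t ^ 2 - y ^ 2), ?_, by positivity, ?_, ?_⟩
  · rwa [add_sub_cancel_left, abs_of_pos ht0]
  · have : √(1 - t ^ 2 - y ^ 2) ≤ 1 := Real.sqrt_le_one.2 (by nlinarith [sq_nonneg y, sq_nonneg t])
    nlinarith
  · refine h _ ⟨by simp only; linarith, by simp only; linarith, ?_⟩
    simp only [tfun, add_sub_cancel_left]
    rw [mul_pow, Real.sq_sqrt hq.le, mul_comm]

section

variable {Ω : Set (ℝ × ℝ × ℝ)} {f : ℝ × ℝ × ℝ → ℝ}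

lemma ZerosAccumulate.eq_zero_on_curve (hΩ : ∀ x y : ℝ, (x, y, (0 : ℝ)) ∈ Ω)
    (hf : AnalyticOnNhd ℝ f Ω) (hz : ZerosAccumulate f) {y : ℝ} (hy : y ∈ Ioo (-1 : ℝ) 1) :
    f (Real.sin (1 / (y + 2)), y, 0) = 0 := by
  by_contra hne
  obtain ⟨ε, hε, hball⟩ := Metric.eventually_nhds_iff.1
    ((hf _ (hΩ _ _)).continuousAt.eventually_ne hne)
  obtain ⟨x, z, hx, hz0, hzε, h0⟩ := hz y hy ε hε
  refine hball (y := (x, y, z)) ?_ h0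
  simp [-one_div, Prod.dist_eq, Real.dist_eq, hx, abs_of_pos hz0, hzε, hε]

lemma ZerosAccumulate.eq_zero_on_plane (hΩ : ∀ x y : ℝ, (x, y, (0 : ℝ)) ∈ Ω)
    (hf : AnalyticOnNhd ℝ f Ω) (hz : ZerosAccumulate f) (x y : ℝ) : f (x, y, 0) = 0 := by
  have hcurve : EqOn (fun y : ℝ => f (Real.sin (1 / (y + 2)), y, 0)) 0 (Ioo (-2) 2) := by
    have hana : AnalyticOnNhd ℝ (fun y : ℝ => f (Real.sin (1 / (y + 2)), y, 0)) (Ioo (-2) 2) := by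
      intro y hy
      have hne : y + 2 ≠ 0 := by linarith [hy.1]
      have hs : AnalyticAt ℝ (fun y : ℝ => Real.sin (1 / (y + 2))) y :=
        Real.analyticAt_sin.comp (analyticAt_const.div (analyticAt_id.add analyticAt_const) hne)
      exact (hf _ (hΩ _ _)).comp (f := fun y : ℝ => (Real.sin (1 / (y + 2)), y, (0 : ℝ)))
        (hs.prod (analyticAt_id.prod analyticAt_const))
    refine hana.eqOn_zero_of_preconnected_of_eventuallyEq_zero (z₀ := 0)
      isPreconnected_Ioo (by norm_num) ?_
    filter_upwards [Ioo_mem_nhds (show (-1 : ℝ) < 0 by norm_num) one_pos] with y hy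
    exact hz.eq_zero_on_curve hΩ hf hy
  have hstrip : ∀ x ∈ Icc (-1 : ℝ) 1, ∀ y, f (x, y, 0) = 0 := by
    intro x hx y
    have hana : AnalyticOnNhd ℝ (fun y : ℝ => f (x, y, 0)) univ := fun y _ =>
      (hf _ (hΩ _ _)).comp (f := fun y : ℝ => (x, y, (0 : ℝ)))
        (analyticAt_const.prod (analyticAt_id.prod analyticAt_const))
    refine hana.eqOn_zero_of_preconnected_of_frequently_eq_zero isPreconnected_univ
      (mem_univ (-2)) ?_ (mem_univ y)
    have ha : Tendsto (fun n : ℕ => Real.arcsin x + n * (2 * Real.pi)) atTop atTop :=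
      tendsto_atTop_add_const_left _ _
        (tendsto_natCast_atTop_atTop.atTop_mul_const Real.two_pi_pos)
    have hlim : Tendsto (fun n : ℕ => -2 + (Real.arcsin x + n * (2 * Real.pi))⁻¹) atTop
        (𝓝[≠] (-2)) := by
      refine tendsto_nhdsWithin_iff.2 ⟨?_, ?_⟩
      · simpa using ha.inv_tendsto_atTop.const_add (-2)
      · filter_upwards [ha.eventually_gt_atTop 0] with n hn
        simp [hn.ne']
    refine hlim.frequently (Eventually.frequently ?_)
    filter_upwards [ha.eventually_gt_atTop 1] with n hn
    have h1 : (Real.arcsin x + n * (2 * Real.pi))⁻¹ < 1 := inv_lt_one_of_one_lt₀ hn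
    have h0 : 0 < (Real.arcsin x + n * (2 * Real.pi))⁻¹ := inv_pos.2 (by linarith)
    have := hcurve (x := -2 + (Real.arcsin x + n * (2 * Real.pi))⁻¹)
      ⟨by linarith, by linarith⟩
    simpa [Real.sin_add_nat_mul_two_pi, Real.sin_arcsin hx.1 hx.2] using this
  have hana : AnalyticOnNhd ℝ (fun x : ℝ => f (x, y, 0)) univ := fun x _ =>
    (hf _ (hΩ _ _)).comp (f := fun x : ℝ => (x, y, (0 : ℝ)))
      (analyticAt_id.prod (analyticAt_const.prod analyticAt_const))
  refine hana.eqOn_zero_of_preconnected_of_eventuallyEq_zero isPreconnected_univ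
    (mem_univ 0) ?_ (mem_univ x)
  filter_upwards [Ioo_mem_nhds (show (-1 : ℝ) < 0 by norm_num) one_pos] with x hx
  exact hstrip x ⟨hx.1.le, hx.2.le⟩ y

lemma ZerosAccumulate.partialZ (hΩo : IsOpen Ω) (hΩ : ∀ x y : ℝ, (x, y, (0 : ℝ)) ∈ Ω)
    (hf : AnalyticOnNhd ℝ f Ω) (hz : ZerosAccumulate f) : ZerosAccumulate (partialZ f) := by
  intro y hy ε hε
  obtain ⟨δ, hδ, hball⟩ := Metric.isOpen_iff.1 hΩo _ (hΩ (Real.sin (1 / (y + 2))) y)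
  obtain ⟨x, z, hx, hz0, hzε, h0⟩ := hz y hy (min ε δ) (lt_min hε hδ)
  rw [lt_min_iff] at hx hzε
  have hd : ∀ w ∈ Icc 0 z, HasDerivAt (fun w => f (x, y, w)) (_root_.partialZ f (x, y, w)) w := by
    intro w hw
    refine hasDerivAt_partialZ (hf _ (hball ?_))
    simp [-one_div, Prod.dist_eq, Real.dist_eq, hx, abs_of_nonneg hw.1, hw.2.trans_lt hzε.2, hδ]
  obtain ⟨w, hw, hw0⟩ := exists_hasDerivAt_eq_zero hz0
    (fun w hw => (hd w hw).continuousAt.continuousWithinAt)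
    ((hz.eq_zero_on_plane hΩ hf x y).trans h0.symm)
    (fun w hw => hd w (Ioo_subset_Icc_self hw))
  exact ⟨x, w, hx.1, hw.1, hw.2.trans hzε.1, hw0⟩

lemma le_analyticOrderAt_of_zerosAccumulate (hΩo : IsOpen Ω)
    (hΩ : ∀ x y : ℝ, (x, y, (0 : ℝ)) ∈ Ω) (x y : ℝ) (n : ℕ) (hf : AnalyticOnNhd ℝ f Ω)
    (hz : ZerosAccumulate f) : (n : ℕ∞) ≤ analyticOrderAt (fun z => f (x, y, z)) 0 := by
  induction n generalizing f with
  | zero => simp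
  | succ n ih =>
    have hana : AnalyticAt ℝ (fun z => f (x, y, z)) 0 :=
      (hf _ (hΩ _ _)).comp (f := fun z : ℝ => (x, y, z))
        (analyticAt_const.prod (analyticAt_const.prod analyticAt_id))
    have hderiv : deriv (fun z => f (x, y, z)) =ᶠ[𝓝 0] fun z => partialZ f (x, y, z) := by
      have hc : ContinuousAt (fun z : ℝ => (x, y, z)) 0 := by fun_prop
      filter_upwards [hc.eventually (hΩo.mem_nhds (hΩ x y))] with z hzΩ
      exact (hasDerivAt_partialZ (hf _ hzΩ)).deriv
    have key := hana.analyticOrderAt_deriv_add_one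
    simp only [hz.eq_zero_on_plane hΩ hf x y, sub_zero] at key
    rw [← key, analyticOrderAt_congr hderiv]
    push_cast
    gcongr
    exact ih hf.partialZ (hz.partialZ hΩo hΩ hf)

lemma ZerosAccumulate.eventuallyEq_zero (hΩo : IsOpen Ω)
    (hΩ : ∀ x y : ℝ, (x, y, (0 : ℝ)) ∈ Ω) (hf : AnalyticOnNhd ℝ f Ω)
    (hz : ZerosAccumulate f) : f =ᶠ[𝓝 (0, 0, 0)] 0 := by
  obtain ⟨δ, hδ, hball⟩ := Metric.isOpen_iff.1 hΩo _ (hΩ 0 0)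
  filter_upwards [Metric.ball_mem_nhds _ hδ]
  rintro ⟨x, y, z⟩ hp
  simp only [Metric.mem_ball, Prod.dist_eq, sup_lt_iff, dist_zero_right] at hp
  have hana : AnalyticOnNhd ℝ (fun z => f (x, y, z)) (Metric.ball 0 δ) := by
    intro w hw
    refine (hf _ (hball ?_)).comp (f := fun z : ℝ => (x, y, z))
      (analyticAt_const.prod (analyticAt_const.prod analyticAt_id))
    simpa only [Metric.mem_ball, Prod.dist_eq, sup_lt_iff, dist_zero_right] using
      ⟨hp.1, hp.2.1, mem_ball_zero_iff.1 hw⟩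
  refine hana.eqOn_zero_of_preconnected_of_eventuallyEq_zero
    (convex_ball (0 : ℝ) δ).isPreconnected (Metric.mem_ball_self hδ) ?_ (by simpa using hp.2.2)
  refine analyticOrderAt_eq_top.1 (ENat.eq_top_iff_forall_ge.2 fun n => ?_)
  exact le_analyticOrderAt_of_zerosAccumulate hΩo hΩ x y n hf hz

end

theorem stmt_1 (Ω : Set (ℝ × ℝ × ℝ)) (hΩopen : IsOpen Ω) (hΩconn : IsConnected Ω)
    (hΩsub : S3 ⊆ Ω) (r : ℝ × ℝ × ℝ → ℝ) (hr : AnalyticOn ℝ r Ω)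
    (hvanish : ∀ p ∈ S3, r p = 0) :
    ∀ p ∈ Ω, r p = 0 := by
  have hplane : ∀ x y : ℝ, (x, y, (0 : ℝ)) ∈ Ω := fun x y => hΩsub (Or.inr rfl)
  have hana : AnalyticOnNhd ℝ r Ω := hΩopen.analyticOn_iff_analyticOnNhd.1 hr
  have hz : ZerosAccumulate r := zerosAccumulate_of_vanish fun p hp => hvanish p (Or.inl hp)
  exact hana.eqOn_zero_of_preconnected_of_eventuallyEq_zero hΩconn.isPreconnected (hplane 0 0)
    (hz.eventuallyEq_zero hΩopen hplane hana)
end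

section
/- S₃ is a real-analytic subvariety of ℝ³: S₃ is closed in ℝ³, and for every p ∈ S₃ there exist an open neighbourhood U of p in ℝ³ and a function f : ℝ³ → ℝ real-analytic on U such that S₃ ∩ U = {q ∈ U : f(q) = 0}. (Near points with -2 < y < 2 one may take f(x,y,z) = z·(z² - (1 - t(x,y)² - y²)·t(x,y)²); near points with y ≤ -2 or y ≥ 2 one may take f(x,y,z) = z, since there S₃ locally coincides with the plane {z = 0}.) -/
/-- `X ⊆ ℝ³` is a real-analytic subvariety of `ℝ³` if it is closed and near
every point of `X` it is the zero set of a real-analytic function. -/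
def IsRealAnalyticSubvariety (X : Set (ℝ × ℝ × ℝ)) : Prop :=
  IsClosed X ∧ ∀ p ∈ X, ∃ U : Set (ℝ × ℝ × ℝ), IsOpen U ∧ p ∈ U ∧
    ∃ f : ℝ × ℝ × ℝ → ℝ, AnalyticOn ℝ f U ∧ X ∩ U = {q ∈ U | f q = 0}

/-- The defining function of `S₂` on the slab `-2 < y < 2`. -/
noncomputable def S2fun (p : ℝ × ℝ × ℝ) : ℝ :=
  p.2.2 ^ 2 - (1 - tfun p.1 p.2.1 ^ 2 - p.2.1 ^ 2) * tfun p.1 p.2.1 ^ 2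

theorem analyticOnNhd_S2fun : AnalyticOnNhd ℝ S2fun {p | -2 < p.2.1} := by
  intro p hp
  have hp : -2 < p.2.1 := hp
  have hne : p.2.1 + 2 ≠ 0 := by linarith
  have hy : AnalyticAt ℝ (fun q : ℝ × ℝ × ℝ => q.2.1) p := analyticAt_fst.comp analyticAt_snd
  have hz : AnalyticAt ℝ (fun q : ℝ × ℝ × ℝ => q.2.2) p := analyticAt_snd.comp analyticAt_snd
  have hsin : AnalyticAt ℝ (fun q : ℝ × ℝ × ℝ => Real.sin (1 / (q.2.1 + 2))) p :=
    Real.analyticAt_sin.comp (analyticAt_const.div (hy.add analyticAt_const) hne)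
  have ht : AnalyticAt ℝ (fun q : ℝ × ℝ × ℝ => tfun q.1 q.2.1) p := analyticAt_fst.sub hsin
  exact (hz.pow 2).sub (((analyticAt_const.sub (ht.pow 2)).sub (hy.pow 2)).mul (ht.pow 2))

theorem sq_le_one_of_S2fun_eq_zero {p : ℝ × ℝ × ℝ} (h : S2fun p = 0) (hz : p.2.2 ≠ 0) :
    p.2.1 ^ 2 ≤ 1 := by
  unfold S2fun at h
  by_contra! hy
  have := pow_pos (abs_pos.2 hz) 2
  rw [sq_abs] at this
  nlinarith [mul_nonneg (sq_nonneg (tfun p.1 p.2.1)) (sq_nonneg (tfun p.1 p.2.1)),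
    mul_nonneg (sub_nonneg.2 hy.le) (sq_nonneg (tfun p.1 p.2.1))]

theorem mem_S3_iff {p : ℝ × ℝ × ℝ} :
    p ∈ S3 ↔ (-1 ≤ p.2.1 ∧ p.2.1 ≤ 1) ∧ S2fun p = 0 ∨ p.2.2 = 0 := by
  constructor
  · rintro (⟨-, -, h⟩ | h)
    · have h0 : S2fun p = 0 := sub_eq_zero.2 h
      by_cases hz : p.2.2 = 0
      · exact Or.inr hz
      · exact Or.inl ⟨abs_le.1 (sq_le_one_iff_abs_le_one _ |>.1
          (sq_le_one_of_S2fun_eq_zero h0 hz)), h0⟩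
    · exact Or.inr h
  · rintro (⟨⟨h1, h2⟩, h⟩ | h)
    · exact Or.inl ⟨by linarith, by linarith, sub_eq_zero.1 h⟩
    · exact Or.inr h

theorem isClosed_S3 : IsClosed S3 := by
  have hS : S3 = ({p : ℝ × ℝ × ℝ | -1 ≤ p.2.1 ∧ p.2.1 ≤ 1} ∩ S2fun ⁻¹' {0}) ∪
      {p | p.2.2 = 0} := Set.ext fun _ => mem_S3_iff
  rw [hS]
  refine IsClosed.union (ContinuousOn.preimage_isClosed_of_isClosed ?_ ?_ isClosed_singleton)
    (isClosed_eq (by fun_prop) continuous_const)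
  · refine analyticOnNhd_S2fun.continuousOn.mono fun p hp => ?_
    have := hp.1
    change -2 < p.2.1
    linarith
  · have hy : Continuous fun q : ℝ × ℝ × ℝ => q.2.1 := by fun_prop
    exact (isClosed_le continuous_const hy).inter
      (isClosed_le hy continuous_const)

theorem stmt_4 : IsRealAnalyticSubvariety S3 := by
  refine ⟨isClosed_S3, fun p _ => ?_⟩
  by_cases hp : -2 < p.2.1 ∧ p.2.1 < 2
  · refine ⟨{q | -2 < q.2.1 ∧ q.2.1 < 2}, ?_, hp, fun q => q.2.2 * S2fun q, ?_, ?_⟩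
    · have hy : Continuous fun q : ℝ × ℝ × ℝ => q.2.1 := by fun_prop
      exact (isOpen_lt continuous_const hy).inter
        (isOpen_lt hy continuous_const)
    · have hz : AnalyticOnNhd ℝ (fun q : ℝ × ℝ × ℝ => q.2.2) {q | -2 < q.2.1} :=
        fun q _ => analyticAt_snd.comp analyticAt_snd
      exact ((hz.mul analyticOnNhd_S2fun).mono fun q hq => hq.1).analyticOn
    · ext q
      have h : S2fun q = 0 ↔
          q.2.2 ^ 2 = (1 - tfun q.1 q.2.1 ^ 2 - q.2.1 ^ 2) * tfun q.1 q.2.1 ^ 2 := sub_eq_zero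
      simp only [S3, S2, Set.mem_inter_iff, Set.mem_union, Set.mem_ofPred_eq, mul_eq_zero, h]
      tauto
  · refine ⟨{q | 1 < q.2.1 ^ 2}, isOpen_lt continuous_const (by fun_prop), ?_,
      fun q => q.2.2, fun q _ => (analyticAt_snd.comp analyticAt_snd).analyticWithinAt, ?_⟩
    · change 1 < p.2.1 ^ 2
      by_contra! h
      have := abs_le.1 (sq_le_one_iff_abs_le_one _ |>.1 h)
      exact hp ⟨by linarith, by linarith⟩
    · ext q
      constructor
      · rintro ⟨h, hq⟩
        refine ⟨hq, ?_⟩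
        rcases mem_S3_iff.1 h with ⟨-, h⟩ | h
        · by_contra hz
          exact absurd (sq_le_one_of_S2fun_eq_zero h hz) (not_le.2 hq)
        · exact h
      · rintro ⟨hq, h⟩
        exact ⟨Or.inr h, hq⟩
end

section
/- If X is a real-analytic subvariety of ℝ³ with I ⊆ X, then X contains the entire plane {(x,y,0) : x, y ∈ ℝ}. In particular, I is not contained in any real-analytic subvariety of ℝ³ that omits any point of the plane {z = 0} (so I is not contained in any one-dimensional subvariety). -/
/-- The curve `I = {(sin(1/(y+2)), y, 0) : -1 ≤ y ≤ 1}`. -/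
noncomputable def Icurve : Set (ℝ × ℝ × ℝ) :=
  {p | ∃ y : ℝ, -1 ≤ y ∧ y ≤ 1 ∧ p = (Real.sin (1 / (y + 2)), y, 0)}

open Filter Topology Set in
/-- If an analytic map on a preconnected set sends a neighbourhood of one point into a real-analytic
subvariety, then it sends the whole set into it. -/
theorem IsRealAnalyticSubvariety.mem_of_isPreconnected {E : Type*} [NormedAddCommGroup E]
    [NormedSpace ℝ E] {X : Set (ℝ × ℝ × ℝ)} (hX : IsRealAnalyticSubvariety X)
    {γ : E → ℝ × ℝ × ℝ} {S : Set E} (hγ : AnalyticOnNhd ℝ γ S) (hS : IsPreconnected S)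
    {a : E} (haS : a ∈ S) (ha : ∀ᶠ t in 𝓝 a, γ t ∈ X) {t : E} (ht : t ∈ S) : γ t ∈ X := by
  suffices h : S ⊆ interior (γ ⁻¹' X) from interior_subset (s := γ ⁻¹' X) (h ht)
  refine hS.subset_of_closure_inter_subset isOpen_interior
    ⟨a, haS, mem_interior_iff_mem_nhds.2 ha⟩ ?_
  rintro p ⟨hp, hpS⟩
  have hcont : ContinuousAt γ p := (hγ p hpS).continuousAt
  have hpX : γ p ∈ X := by
    have h : γ p ∈ closure X := hcont.continuousWithinAt.mem_closure hp
      (fun x hx => interior_subset (s := γ ⁻¹' X) hx)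
    rwa [hX.1.closure_eq] at h
  obtain ⟨U, hUo, hpU, f, hf, hfX⟩ := hX.2 _ hpX
  rw [hUo.analyticOn_iff_analyticOnNhd] at hf
  have hev : ∀ᶠ q in 𝓝 p, AnalyticAt ℝ γ q ∧ γ q ∈ U :=
    (hγ p hpS).eventually_analyticAt.and (hcont.eventually_mem (hUo.mem_nhds hpU))
  obtain ⟨r, hr, hball⟩ := Metric.eventually_nhds_iff_ball.1 hev
  obtain ⟨q, hq, hqr⟩ := Metric.mem_closure_iff.1 hp r hr
  have hqb : q ∈ Metric.ball p r := by rwa [Metric.mem_ball, dist_comm]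
  have han : AnalyticOnNhd ℝ (f ∘ γ) (Metric.ball p r) := fun x hx =>
    (hf _ (hball x hx).2).comp (hball x hx).1
  have hzero : (f ∘ γ) =ᶠ[𝓝 q] 0 := by
    filter_upwards [isOpen_interior.mem_nhds hq, Metric.isOpen_ball.mem_nhds hqb] with x hx hxb
    have : γ x ∈ X ∩ U := ⟨interior_subset (s := γ ⁻¹' X) hx, (hball x hxb).2⟩
    rw [hfX] at this
    exact this.2
  have hall := han.eqOn_zero_of_preconnected_of_eventuallyEq_zero
    (convex_ball p r).isPreconnected hqb hzero
  rw [mem_interior_iff_mem_nhds]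
  filter_upwards [Metric.ball_mem_nhds p hr] with x hx
  have : γ x ∈ X ∩ U := by
    rw [hfX]
    exact ⟨(hball x hx).2, hall hx⟩
  exact this.1

open Filter Topology in
/-- Every value in `[-1, 1]` is taken by `sin (1 / (y + 2))` arbitrarily close to `y = -2` on the
right. -/
theorem frequently_sin_one_div_add_two_eq {x : ℝ} (h₁ : -1 ≤ x) (h₂ : x ≤ 1) :
    ∃ᶠ y in 𝓝[>] (-2 : ℝ), Real.sin (1 / (y + 2)) = x := by
  have htop : Tendsto (fun k : ℕ => Real.arcsin x + k * (2 * Real.pi)) atTop atTop :=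
    tendsto_atTop_add_const_left _ _
      (tendsto_natCast_atTop_atTop.atTop_mul_const Real.two_pi_pos)
  have hlim : Tendsto (fun k : ℕ => -2 + (Real.arcsin x + k * (2 * Real.pi))⁻¹) atTop
      (𝓝[>] (-2 : ℝ)) := by
    refine tendsto_nhdsWithin_iff.2 ⟨?_, ?_⟩
    · simpa using (tendsto_inv_atTop_zero.comp htop).const_add (-2 : ℝ)
    · filter_upwards [htop.eventually_gt_atTop 0] with k hk
      have := inv_pos.2 hk
      simp only [Set.mem_Ioi]
      linarith
  refine hlim.frequently (Frequently.of_forall fun k => ?_)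
  simp only [neg_add_cancel_comm, one_div, inv_inv]
  rw [Real.sin_add_nat_mul_two_pi, Real.sin_arcsin h₁ h₂]

theorem stmt_8 (X : Set (ℝ × ℝ × ℝ)) (hX : IsRealAnalyticSubvariety X)
    (hIX : Icurve ⊆ X) :
    {p : ℝ × ℝ × ℝ | p.2.2 = 0} ⊆ X := by
  have hcurve : ∀ y : ℝ, -2 < y → (Real.sin (1 / (y + 2)), y, (0 : ℝ)) ∈ X := by
    intro y hy
    refine hX.mem_of_isPreconnected (γ := fun y : ℝ => (Real.sin (1 / (y + 2)), y, (0 : ℝ)))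
      (S := Set.Ioi (-2)) (a := 0) ?_ isPreconnected_Ioi (by simp) ?_ hy
    · intro t ht
      have h0 : t + 2 ≠ 0 := by
        have : -2 < t := ht
        linarith
      have h1 : AnalyticAt ℝ (fun y : ℝ => 1 / (y + 2)) t :=
        analyticAt_const.div (analyticAt_id.add analyticAt_const) h0
      exact (Real.analyticAt_sin.comp h1).prod (analyticAt_id.prod analyticAt_const)
    · filter_upwards [Icc_mem_nhds (show (-1 : ℝ) < 0 by norm_num) one_pos] with t ht
      exact hIX ⟨t, ht.1, ht.2, rfl⟩
  have hplane : ∀ t : ℝ × ℝ, AnalyticAt ℝ (fun t : ℝ × ℝ => (t.1, t.2, (0 : ℝ))) t := fun t =>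
    analyticAt_fst.prod (analyticAt_snd.prod analyticAt_const)
  have hmem : ∀ x : ℝ, -1 ≤ x → x ≤ 1 → ∃ᶠ y in nhdsWithin (-2 : ℝ) (Set.Ioi (-2)), (x, y, (0 : ℝ)) ∈ X := by
    intro x h₁ h₂
    refine ((frequently_sin_one_div_add_two_eq h₁ h₂).and_eventually
      self_mem_nhdsWithin).mono ?_
    rintro y ⟨rfl, hy⟩
    exact hcurve y hy
  have hlimit : ((0 : ℝ), (-2 : ℝ), (0 : ℝ)) ∈ X := by
    have hc : Continuous fun y : ℝ => ((0 : ℝ), y, (0 : ℝ)) := by fun_prop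
    exact (hX.1.preimage hc).mem_of_frequently_of_tendsto
      (hmem 0 (by norm_num) (by norm_num)) (Filter.tendsto_id.mono_left nhdsWithin_le_nhds)
  have hloc : ∀ᶠ t : ℝ × ℝ in nhds (0, -2), (t.1, t.2, (0 : ℝ)) ∈ X := by
    obtain ⟨U, hUo, hpU, f, hf, hfX⟩ := hX.2 _ hlimit
    rw [hUo.analyticOn_iff_analyticOnNhd] at hf
    obtain ⟨r, hr, hball⟩ := Metric.eventually_nhds_iff_ball.1
      ((hplane (0, -2)).continuousAt.eventually_mem (hUo.mem_nhds hpU))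
    filter_upwards [Metric.ball_mem_nhds _ hr,
      prod_mem_nhds (Icc_mem_nhds (show (-1 : ℝ) < 0 by norm_num) one_pos) Filter.univ_mem]
      with ⟨x, y⟩ hxy hx
    rw [← ball_prod_same] at hxy hball
    have hU : ∀ s ∈ Metric.ball (-2 : ℝ) r, (x, s, (0 : ℝ)) ∈ U := fun s hs =>
      hball (x, s) ⟨hxy.1, hs⟩
    have han : AnalyticOnNhd ℝ (fun s : ℝ => f (x, s, 0)) (Metric.ball (-2) r) := fun s hs =>
      (hf _ (hU s hs)).comp (f := fun s : ℝ => (x, s, (0 : ℝ)))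
        (analyticAt_const.prod (analyticAt_id.prod analyticAt_const))
    have hfreq : ∃ᶠ s in nhdsWithin (-2 : ℝ) {-2}ᶜ, f (x, s, 0) = 0 := by
      have h := (hmem x hx.1.1 hx.1.2).and_eventually
        (nhdsWithin_le_nhds (Metric.ball_mem_nhds (-2 : ℝ) hr))
      refine (h.filter_mono (nhdsWithin_mono _ fun s hs => ne_of_gt hs)).mono ?_
      rintro s ⟨hs, hsr⟩
      have : (x, s, (0 : ℝ)) ∈ X ∩ U := ⟨hs, hU s hsr⟩
      rw [hfX] at this
      exact this.2
    have hzero := han.eqOn_zero_of_preconnected_of_frequently_eq_zero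
      (convex_ball _ r).isPreconnected (Metric.mem_ball_self hr) hfreq hxy.2
    have : (x, y, (0 : ℝ)) ∈ X ∩ U := by
      rw [hfX]
      exact ⟨hU y hxy.2, hzero⟩
    exact this.1
  rintro ⟨x, y, z⟩ rfl
  exact hX.mem_of_isPreconnected (fun t _ => hplane t) isPreconnected_univ (Set.mem_univ _) hloc
    (Set.mem_univ (x, y))
end
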